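/- arXiv:2605.24819 — 2 statements merged into one kernel-verified Lean document; each statement's English description precedes it below -/
import Mathlib

section
/- Let P ∈ ℝ^{d×n} be a Haar–Stiefel matrix with 2 ≤ d ≤ n. Then for all unit vectors u, v ∈ ℝⁿ with ⟨u,v⟩ < 1, E[Γ(P;u,v)] ≥ (d−1)/(96(n−1)). -/
open MeasureTheory Matrix

/-- Measurable space structure on real matrices (as a pi type). -/
instance {d n : ℕ} : MeasurableSpace (Matrix (Fin d) (Fin n) ℝ) :=
  inferInstanceAs (MeasurableSpace (Fin d → Fin n → ℝ))

/-- Euclidean inner product on `m → ℝ`. -/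
noncomputable def dotR {m : Type*} [Fintype m] (x y : m → ℝ) : ℝ := ∑ i, x i * y i

/-- Euclidean norm on `m → ℝ`. -/
noncomputable def norR {m : Type*} [Fintype m] (x : m → ℝ) : ℝ := Real.sqrt (dotR x x)

/-- The section-efficiency ratio Γ(P;u,v) = (‖Pu‖‖Pv‖ − ⟨Pu,Pv⟩)/(1 − ⟨u,v⟩). -/
noncomputable def Gam {d n : ℕ} (P : Matrix (Fin d) (Fin n) ℝ) (u v : Fin n → ℝ) : ℝ :=
  (norR (P.mulVec u) * norR (P.mulVec v) - dotR (P.mulVec u) (P.mulVec v)) / (1 - dotR u v)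

/-- `μ` is the Haar–Stiefel distribution: a probability measure supported on the
Stiefel manifold `{P : P Pᵀ = I_d}` that is invariant under right multiplication
by any orthogonal matrix.  (This characterizes the law of the first `d` rows of a
Haar-distributed orthogonal matrix.) -/
def IsHaarStiefel {d n : ℕ} (μ : Measure (Matrix (Fin d) (Fin n) ℝ)) : Prop :=
  IsProbabilityMeasure μ ∧
  (∀ᵐ P ∂μ, P * Pᵀ = 1) ∧
  ∀ Q : Matrix (Fin n) (Fin n) ℝ, Q ∈ Matrix.orthogonalGroup (Fin n) ℝ →
    μ.map (fun P => P * Q) = μ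


theorem aux_dot {m : Type*} [Fintype m] (x y : m → ℝ) : dotR x y = x ⬝ᵥ y := rfl

theorem aux_nonneg {m : Type*} [Fintype m] (x : m → ℝ) : 0 ≤ x ⬝ᵥ x :=
  Finset.sum_nonneg fun i _ => mul_self_nonneg (x i)

theorem aux_cs {m : Type*} [Fintype m] (x y : m → ℝ) :
    (x ⬝ᵥ y) ^ 2 ≤ (x ⬝ᵥ x) * (y ⬝ᵥ y) := by
  have := Finset.sum_mul_sq_le_sq_mul_sq Finset.univ x y
  simpa [dotProduct, pow_two] using this

/-- pointwise inequality -/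
theorem aux_pt {m : Type*} [Fintype m] (a b : m → ℝ) :
    (1 / 2) * ((a - b) ⬝ᵥ (a - b) - ((a + b) ⬝ᵥ (a - b)) ^ 2 / ((a + b) ⬝ᵥ (a + b))) ≤
      norR a * norR b - dotR a b := by
  have hA := aux_nonneg a
  have hB := aux_nonneg b
  have hC := aux_cs a b
  have hS := aux_nonneg (a + b)
  have e1 : (a - b) ⬝ᵥ (a - b) = a ⬝ᵥ a + b ⬝ᵥ b - 2 * (a ⬝ᵥ b) := by
    simp only [sub_dotProduct, dotProduct_sub, dotProduct_comm b a]; ring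
  have e2 : (a + b) ⬝ᵥ (a + b) = a ⬝ᵥ a + b ⬝ᵥ b + 2 * (a ⬝ᵥ b) := by
    simp only [add_dotProduct, dotProduct_add, dotProduct_comm b a]; ring
  have e3 : (a + b) ⬝ᵥ (a - b) = a ⬝ᵥ a - b ⬝ᵥ b := by
    simp only [add_dotProduct, dotProduct_sub, dotProduct_comm b a]; ring
  rw [e2] at hS
  rw [e1, e2, e3]
  unfold norR
  rw [aux_dot, aux_dot, aux_dot]
  generalize a ⬝ᵥ a = A at *
  generalize b ⬝ᵥ b = B at *
  generalize a ⬝ᵥ b = C at *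
  have hx := Real.sqrt_nonneg A
  have hy := Real.sqrt_nonneg B
  have hx2 := Real.sq_sqrt hA
  have hy2 := Real.sq_sqrt hB
  generalize √A = x at *
  generalize √B = y at *
  subst hx2 hy2
  have hab : |C| ≤ x * y := by
    apply abs_le_of_sq_le_sq _ (mul_nonneg hx hy)
    rw [mul_pow]; exact hC
  have hCm : C ≤ x * y := (abs_le.1 hab).2
  have hCm' : -(x * y) ≤ C := (abs_le.1 hab).1
  rcases hS.eq_or_lt with h | h
  · rw [← h]
    simp
    nlinarith [sq_nonneg (x - y)]
  · have : (1 / 2) * (x ^ 2 + y ^ 2 - 2 * C - (x ^ 2 - y ^ 2) ^ 2 / (x ^ 2 + y ^ 2 + 2 * C))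
      = 2 * (x * y - C) * (x * y + C) / (x ^ 2 + y ^ 2 + 2 * C) := by
      field_simp; ring
    rw [this, div_le_iff₀ h]
    nlinarith [mul_nonneg (sub_nonneg.2 hCm) (sq_nonneg (x - y))]

theorem aux_scale {m : Type*} [Fintype m] (p y : m → ℝ) (t : ℝ) :
    ((t • p) ⬝ᵥ y) ^ 2 / ((t • p) ⬝ᵥ (t • p)) ≤ (p ⬝ᵥ y) ^ 2 / (p ⬝ᵥ p) := by
  rcases eq_or_ne t 0 with rfl | ht
  · simpa using div_nonneg (sq_nonneg _) (aux_nonneg p)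
  · apply le_of_eq
    simp only [smul_dotProduct, dotProduct_smul, smul_eq_mul]
    rw [show (t * p ⬝ᵥ y) ^ 2 = (t * t) * (p ⬝ᵥ y) ^ 2 by ring, ← mul_assoc,
      mul_div_mul_left _ _ (mul_ne_zero ht ht)]

/-- residual of column i after projecting out column i0 -/
noncomputable def auxR {d n : ℕ} (i0 i : Fin n) (P : Matrix (Fin d) (Fin n) ℝ) : ℝ :=
  Pᵀ i ⬝ᵥ Pᵀ i - (Pᵀ i0 ⬝ᵥ Pᵀ i) ^ 2 / (Pᵀ i0 ⬝ᵥ Pᵀ i0)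

theorem aux_basis {n : ℕ} (i0 i1 : Fin n) (h01 : i0 ≠ i1) (u v : Fin n → ℝ)
    (hu : u ⬝ᵥ u = 1) (hv : v ⬝ᵥ v = 1) (huv : u ⬝ᵥ v < 1) :
    ∃ B ∈ Matrix.orthogonalGroup (Fin n) ℝ, ∃ t s : ℝ,
      u + v = t • Bᵀ i0 ∧ u - v = s • Bᵀ i1 ∧ s ^ 2 = 2 * (1 - u ⬝ᵥ v) := by
  have hz : (u - v) ⬝ᵥ (u - v) = 2 * (1 - u ⬝ᵥ v) := by
    simp only [sub_dotProduct, dotProduct_sub, dotProduct_comm v u, hu, hv]; ring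
  have hwz : (u + v) ⬝ᵥ (u - v) = 0 := by
    simp only [add_dotProduct, dotProduct_sub, dotProduct_comm v u, hu, hv]; ring
  let w' : EuclideanSpace ℝ (Fin n) := WithLp.toLp 2 (u + v)
  let z' : EuclideanSpace ℝ (Fin n) := WithLp.toLp 2 (u - v)
  have inn : ∀ x y : EuclideanSpace ℝ (Fin n), inner ℝ x y = x.ofLp ⬝ᵥ y.ofLp := by
    intro x y
    rw [EuclideanSpace.inner_eq_star_dotProduct, dotProduct_comm]; simp
  have hzz : ‖z'‖ ^ 2 = 2 * (1 - u ⬝ᵥ v) := by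
    rw [← real_inner_self_eq_norm_sq, inn]; exact hz
  have hwz' : inner ℝ w' z' = 0 := by rw [inn]; exact hwz
  have hz0 : z' ≠ 0 := by
    intro h; rw [h] at hzz; simp at hzz; linarith
  have hzn : ‖z'‖ ≠ 0 := norm_ne_zero_iff.2 hz0
  have key : ∃ b : OrthonormalBasis (Fin n) ℝ (EuclideanSpace ℝ (Fin n)),
      w' = ‖w'‖ • b i0 ∧ z' = ‖z'‖ • b i1 := by
    let vv : Fin n → EuclideanSpace ℝ (Fin n) := fun i =>
      if i = i0 then ‖w'‖⁻¹ • w' else ‖z'‖⁻¹ • z'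
    have v1 : vv i1 = ‖z'‖⁻¹ • z' := if_neg h01.symm
    have v0 : vv i0 = ‖w'‖⁻¹ • w' := if_pos rfl
    have hzs : z' = ‖z'‖ • (‖z'‖⁻¹ • z') := by rw [smul_smul, mul_inv_cancel₀ hzn, one_smul]
    by_cases hw : w' = 0
    · have ho : Orthonormal ℝ (({i1} : Set (Fin n)).domRestrict vv) := by
        constructor
        · rintro ⟨i, rfl⟩
          change ‖vv _‖ = 1
          rw [v1, norm_smul, norm_inv, norm_norm, inv_mul_cancel₀ hzn]
        · rintro ⟨i, rfl⟩ ⟨j, rfl⟩ hij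
          exact absurd rfl hij
      obtain ⟨b, hb⟩ := ho.exists_orthonormalBasis_extension_of_card_eq (by simp)
      refine ⟨b, by simp [hw], ?_⟩
      rw [hb i1 rfl, v1]; exact hzs
    · have hwn : ‖w'‖ ≠ 0 := norm_ne_zero_iff.2 hw
      have ho : Orthonormal ℝ (({i0, i1} : Set (Fin n)).domRestrict vv) := by
        constructor
        · rintro ⟨i, rfl | rfl⟩
          · change ‖vv _‖ = 1
            rw [v0, norm_smul, norm_inv, norm_norm, inv_mul_cancel₀ hwn]
          · change ‖vv _‖ = 1
            rw [v1, norm_smul, norm_inv, norm_norm, inv_mul_cancel₀ hzn]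
        · rintro ⟨i, rfl | rfl⟩ ⟨j, rfl | rfl⟩ hij
          · exact absurd rfl hij
          · change inner ℝ (vv _) (vv _) = 0
            rw [v0, v1, inner_smul_left, inner_smul_right, hwz']; simp
          · change inner ℝ (vv _) (vv _) = 0
            rw [v0, v1, inner_smul_left, inner_smul_right, real_inner_comm, hwz']; simp
          · exact absurd rfl hij
      obtain ⟨b, hb⟩ := ho.exists_orthonormalBasis_extension_of_card_eq (by simp)
      refine ⟨b, ?_, ?_⟩
      · rw [hb i0 (by simp), v0, smul_smul, mul_inv_cancel₀ hwn, one_smul]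
      · rw [hb i1 (by simp), v1]; exact hzs
  obtain ⟨b, hb0, hb1⟩ := key
  refine ⟨Matrix.of fun k i => b i k, ?_, ‖w'‖, ‖z'‖, ?_, ?_, hzz⟩
  · rw [Matrix.mem_orthogonalGroup_iff']
    ext i j
    have := orthonormal_iff_ite.1 b.orthonormal i j
    rw [inn] at this
    rw [Matrix.one_apply, ← this]
    rfl
  · exact congrArg WithLp.ofLp hb0
  · exact congrArg WithLp.ofLp hb1

theorem aux_col {d n : ℕ} (P : Matrix (Fin d) (Fin n) ℝ) (B : Matrix (Fin n) (Fin n) ℝ)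
    (i : Fin n) : P.mulVec (Bᵀ i) = (P * B)ᵀ i := rfl

theorem aux_le {d n : ℕ} (P : Matrix (Fin d) (Fin n) ℝ) (B : Matrix (Fin n) (Fin n) ℝ)
    (i0 i1 : Fin n) (u v : Fin n → ℝ) (t s : ℝ) (huv : u ⬝ᵥ v < 1)
    (hw : u + v = t • Bᵀ i0) (hz : u - v = s • Bᵀ i1) (hs : s ^ 2 = 2 * (1 - u ⬝ᵥ v)) :
    auxR i0 i1 (P * B) ≤ Gam P u v := by
  unfold Gam auxR
  rw [le_div_iff₀ (by rw [aux_dot]; linarith)]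
  refine le_trans ?_ (aux_pt _ _)
  rw [← Matrix.mulVec_add, ← Matrix.mulVec_sub, hw, hz, Matrix.mulVec_smul, Matrix.mulVec_smul,
    aux_col, aux_col, aux_dot]
  have := aux_scale ((P * B)ᵀ i0) (s • (P * B)ᵀ i1) t
  have h2 : ((P * B)ᵀ i0 ⬝ᵥ (s • (P * B)ᵀ i1)) ^ 2 / ((P * B)ᵀ i0 ⬝ᵥ (P * B)ᵀ i0)
     = s ^ 2 * (((P * B)ᵀ i0 ⬝ᵥ (P * B)ᵀ i1) ^ 2 / ((P * B)ᵀ i0 ⬝ᵥ (P * B)ᵀ i0)) := by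
    simp only [dotProduct_smul, smul_eq_mul]; ring
  have h3 : (s • (P * B)ᵀ i1) ⬝ᵥ (s • (P * B)ᵀ i1) = s ^ 2 * ((P * B)ᵀ i1 ⬝ᵥ (P * B)ᵀ i1) := by
    simp only [dotProduct_smul, smul_dotProduct, smul_eq_mul]; ring
  rw [h3]
  rw [h2] at this
  rw [hs] at this ⊢
  linarith

theorem aux_zero {d n : ℕ} (i0 : Fin n) (P : Matrix (Fin d) (Fin n) ℝ) : auxR i0 i0 P = 0 := by
  unfold auxR
  rcases eq_or_ne (Pᵀ i0 ⬝ᵥ Pᵀ i0) 0 with h | h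
  · simp [h]
  · field_simp; simp

theorem aux_sum {d n : ℕ} (i0 : Fin n) (P : Matrix (Fin d) (Fin n) ℝ) (hP : P * Pᵀ = 1) :
    (d : ℝ) - 1 ≤ ∑ i, auxR i0 i P := by
  unfold auxR
  rw [Finset.sum_sub_distrib, ← Finset.sum_div]
  have h1 : ∑ i, Pᵀ i ⬝ᵥ Pᵀ i = d := by
    have := congrArg Matrix.trace hP
    rw [Matrix.trace_mul_comm] at this
    rw [Matrix.trace_one, Fintype.card_fin] at this
    exact this
  have h2 : ∑ i, (Pᵀ i0 ⬝ᵥ Pᵀ i) ^ 2 = Pᵀ i0 ⬝ᵥ Pᵀ i0 := by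
    have h : (Pᵀ * P) * (Pᵀ * P) = Pᵀ * P := by
      rw [Matrix.mul_assoc, ← Matrix.mul_assoc P, hP, Matrix.one_mul]
    have := congrFun (congrFun h i0) i0
    rw [Matrix.mul_apply] at this
    have e : ∀ i j, (Pᵀ * P) i j = Pᵀ i ⬝ᵥ Pᵀ j := fun i j => rfl
    simp only [e] at this
    rw [← this]
    refine Finset.sum_congr rfl fun i _ => ?_
    rw [dotProduct_comm (Pᵀ i)]; ring
  rw [h1, h2]
  have := div_self_le_one (Pᵀ i0 ⬝ᵥ Pᵀ i0)
  linarith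

theorem aux_entry {d n : ℕ} (i : Fin d) (j : Fin n) :
    Measurable fun P : Matrix (Fin d) (Fin n) ℝ => P i j :=
  (measurable_pi_apply j).comp (measurable_pi_apply (X := fun _ : Fin d => Fin n → ℝ) i)

theorem aux_measR {d n : ℕ} (i0 i : Fin n) :
    Measurable (auxR i0 i : Matrix (Fin d) (Fin n) ℝ → ℝ) := by
  have h : ∀ i j : Fin n, Measurable fun P : Matrix (Fin d) (Fin n) ℝ => Pᵀ i ⬝ᵥ Pᵀ j :=
    fun i j => Finset.measurable_sum _ fun k _ => (aux_entry k i).mul (aux_entry k j)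
  unfold auxR
  exact (h i i).sub (((h i0 i).pow_const 2).div (h i0 i0))

theorem aux_measG {d n : ℕ} (u v : Fin n → ℝ) :
    Measurable (fun P : Matrix (Fin d) (Fin n) ℝ => Gam P u v) := by
  have h0 : ∀ (u : Fin n → ℝ) k, Measurable fun P : Matrix (Fin d) (Fin n) ℝ => (P.mulVec u) k :=
    fun u k => Finset.measurable_sum Finset.univ fun j _ => (aux_entry k j).mul_const (u j)
  have h : ∀ u v : Fin n → ℝ, Measurable fun P : Matrix (Fin d) (Fin n) ℝ =>
      dotR (P.mulVec u) (P.mulVec v) :=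
    fun u v => Finset.measurable_sum _ fun k _ => (h0 u k).mul (h0 v k)
  unfold Gam norR
  exact (((h u u).sqrt.mul (h v v).sqrt).sub (h u v)).div_const _

theorem aux_measMul {d n : ℕ} (B : Matrix (Fin n) (Fin n) ℝ) :
    Measurable (fun P : Matrix (Fin d) (Fin n) ℝ => P * B) := by
  refine measurable_pi_lambda (X := fun _ : Fin d => Fin n → ℝ) _ fun i =>
    measurable_pi_lambda _ fun j => ?_
  exact Finset.measurable_sum Finset.univ fun k _ => (aux_entry i k).mul_const (B k j)

theorem aux_ent_le {d n : ℕ} (P : Matrix (Fin d) (Fin n) ℝ) (hP : P * Pᵀ = 1) (i : Fin d)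
    (j : Fin n) : |P i j| ≤ 1 := by
  have := congrFun (congrFun hP i) i
  rw [Matrix.mul_apply, Matrix.one_apply_eq] at this
  rw [← sq_le_one_iff_abs_le_one, ← this, pow_two]
  exact Finset.single_le_sum (f := fun j => P i j * Pᵀ j i) (fun k _ => mul_self_nonneg (P i k))
    (Finset.mem_univ j)

theorem aux_boundG {d n : ℕ} (u v : Fin n → ℝ) :
    ∃ C : ℝ, ∀ P : Matrix (Fin d) (Fin n) ℝ, P * Pᵀ = 1 → ‖Gam P u v‖ ≤ C := by
  have hK : IsCompact (Set.Icc (-1) 1 : Set (Fin d → Fin n → ℝ)) := isCompact_Icc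
  have hc : Continuous fun P : Fin d → Fin n → ℝ => Gam (Matrix.of P) u v := by
    unfold Gam norR dotR Matrix.mulVec dotProduct
    simp only [Matrix.of_apply]
    fun_prop
  obtain ⟨C, hC⟩ := hK.exists_bound_of_continuousOn hc.continuousOn
  refine ⟨C, fun P hP => hC P ⟨fun i j => ?_, fun i j => ?_⟩⟩
  · exact (abs_le.1 (aux_ent_le P hP i j)).1
  · exact (abs_le.1 (aux_ent_le P hP i j)).2

theorem aux_boundR {d n : ℕ} (i0 i : Fin n) (P : Matrix (Fin d) (Fin n) ℝ) (hP : P * Pᵀ = 1) :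
    ‖auxR i0 i P‖ ≤ d := by
  have h0 : Pᵀ i ⬝ᵥ Pᵀ i ≤ d := by
    calc Pᵀ i ⬝ᵥ Pᵀ i ≤ ∑ k : Fin d, (1 : ℝ) := Finset.sum_le_sum fun k _ => by
          have := aux_ent_le P hP k i
          rw [← sq_le_one_iff_abs_le_one, pow_two] at this
          exact this
      _ = d := by simp
  have h1 := aux_cs (Pᵀ i0) (Pᵀ i)
  have h2 := aux_nonneg (Pᵀ i0)
  have h3 := aux_nonneg (Pᵀ i)
  have h4 : (Pᵀ i0 ⬝ᵥ Pᵀ i) ^ 2 / (Pᵀ i0 ⬝ᵥ Pᵀ i0) ≤ Pᵀ i ⬝ᵥ Pᵀ i :=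
    div_le_of_le_mul₀ h2 h3 (by rw [mul_comm]; exact h1)
  have h5 : 0 ≤ (Pᵀ i0 ⬝ᵥ Pᵀ i) ^ 2 / (Pᵀ i0 ⬝ᵥ Pᵀ i0) := div_nonneg (sq_nonneg _) h2
  unfold auxR
  rw [Real.norm_eq_abs, abs_le]
  constructor <;> linarith

/-- Determinant-based angle-uniform lower bound:
`E[Γ(P;u,v)] ≥ (d−1)/(96(n−1))` for Haar–Stiefel `P` with `2 ≤ d ≤ n` and all
unit vectors `u, v` with `⟨u,v⟩ < 1`. -/
theorem expected_Gamma_determinant_lower_bound {n d : ℕ} (hd2 : 2 ≤ d) (hdn : d ≤ n)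
    (μ : Measure (Matrix (Fin d) (Fin n) ℝ)) (hμ : IsHaarStiefel μ)
    (u v : Fin n → ℝ) (hu : dotR u u = 1) (hv : dotR v v = 1) (huv : dotR u v < 1) :
    ((d : ℝ) - 1) / (96 * ((n : ℝ) - 1)) ≤ ∫ P, Gam P u v ∂μ := by
  obtain ⟨hp, hS, hI⟩ := hμ
  rw [aux_dot] at hu hv huv
  let i0 : Fin n := ⟨0, by omega⟩
  let i1 : Fin n := ⟨1, by omega⟩
  have h01 : i0 ≠ i1 := by simp [i0, i1]
  obtain ⟨B, hB, t, s, hw, hz, hs⟩ := aux_basis i0 i1 h01 u v hu hv huv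
  have inv : ∀ Q ∈ Matrix.orthogonalGroup (Fin n) ℝ, ∀ i : Fin n,
      ∫ P, auxR i0 i (P * Q) ∂μ = ∫ P, auxR i0 i P ∂μ := by
    intro Q hQ i
    conv_rhs => rw [← hI Q hQ]
    rw [integral_map (aux_measMul Q).aemeasurable (aux_measR i0 i).aestronglyMeasurable]
  have intR : ∀ i, Integrable (auxR i0 i) μ := fun i =>
    Integrable.of_bound (aux_measR i0 i).aestronglyMeasurable (d : ℝ)
      (hS.mono fun P hP => aux_boundR i0 i P hP)
  obtain ⟨C, hC⟩ := aux_boundG (d := d) u v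
  have intG : Integrable (fun P => Gam P u v) μ :=
    Integrable.of_bound (aux_measG u v).aestronglyMeasurable C (hS.mono fun P hP => hC P hP)
  have intRB : Integrable (fun P => auxR i0 i1 (P * B)) μ := by
    have := intR i1
    rw [← hI B hB] at this
    exact this.comp_measurable (aux_measMul B)
  have hle : ∫ P, auxR i0 i1 P ∂μ ≤ ∫ P, Gam P u v ∂μ := by
    rw [← inv B hB i1]
    exact integral_mono intRB intG fun P => aux_le P B i0 i1 u v t s huv hw hz hs
  have hsame : ∀ i, i ≠ i0 → ∫ P, auxR i0 i P ∂μ = ∫ P, auxR i0 i1 P ∂μ := by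
    intro i hi
    let σ : Equiv.Perm (Fin n) := Equiv.swap i i1
    let Q : Matrix (Fin n) (Fin n) ℝ := (1 : Matrix (Fin n) (Fin n) ℝ).submatrix id σ
    have hQ : Q ∈ Matrix.orthogonalGroup (Fin n) ℝ := by
      rw [Matrix.mem_orthogonalGroup_iff']
      ext a b
      simp [Q, Matrix.mul_apply, Matrix.star_apply, Matrix.one_apply]
    have hm : ∀ P : Matrix (Fin d) (Fin n) ℝ, P * Q = P.submatrix id σ := by
      intro P
      ext a b
      simp [Q, Matrix.mul_apply, Matrix.one_apply]
    rw [← inv Q hQ i]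
    refine integral_congr_ae (Filter.Eventually.of_forall fun P => ?_)
    have s0 : σ i0 = i0 := Equiv.swap_apply_of_ne_of_ne hi.symm h01
    have s1 : σ i = i1 := Equiv.swap_apply_left _ _
    have c : ∀ j, (P * Q)ᵀ j = Pᵀ (σ j) := by intro j; rw [hm]; rfl
    simp only [auxR, c, s0, s1]
  have hsum : (d : ℝ) - 1 ≤ ∑ i, ∫ P, auxR i0 i P ∂μ := by
    rw [← integral_finsetSum _ fun i _ => intR i]
    have := integral_mono_ae (integrable_const ((d : ℝ) - 1))
      (integrable_finsetSum Finset.univ fun i _ => intR i)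
      (hS.mono fun P hP => aux_sum i0 P hP)
    simpa using this
  rw [← Finset.add_sum_erase _ _ (Finset.mem_univ i0),
    Finset.sum_congr rfl fun i hi => hsame i (Finset.ne_of_mem_erase hi)] at hsum
  simp only [aux_zero, integral_zero, Finset.sum_const, zero_add,
    Finset.card_erase_of_mem (Finset.mem_univ i0), Finset.card_univ, Fintype.card_fin,
    nsmul_eq_mul] at hsum
  rw [Nat.cast_sub (by omega), Nat.cast_one] at hsum
  have hd : (2 : ℝ) ≤ d := by exact_mod_cast hd2
  have hn : (2 : ℝ) ≤ n := by exact_mod_cast hd2.trans hdn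
  refine le_trans ?_ hle
  rw [div_le_iff₀ (by linarith)]
  nlinarith
end

section
/- There exist universal constants c > 0 and C > 0 such that the following holds. Let n ≥ 1, let H ∈ ℝ^{n×n} be a symmetric positive semidefinite matrix, let λ̄ := tr(H)/n and H_c := H − λ̄·I_n, let 1 ≤ d ≤ n, let P ∈ ℝ^{d×n} be a Haar–Stiefel matrix, and let η ∈ (0,1). Define err := C·((‖H_c‖_F/n)·√(d + log(2/η)) + (‖H_c‖₂/n)·(d + log(2/η))). Then with probability at least 1 − η, the operator norm satisfies ‖P H Pᵀ − λ̄·I_d‖ ≤ err; consequently all eigenvalues of P H Pᵀ lie in the interval [max{λ̄ − err, 0}, λ̄ + err]. -/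
open MeasureTheory Matrix

/-- Spectral (operator) norm of a real matrix, via the induced operator norm on
Euclidean spaces. -/
noncomputable def specNorm {a b : ℕ} (H : Matrix (Fin a) (Fin b) ℝ) : ℝ :=
  ‖LinearMap.toContinuousLinearMap (Matrix.toEuclideanLin H)‖

/-- Frobenius norm of a real matrix. -/
noncomputable def frobNorm {a b : ℕ} (H : Matrix (Fin a) (Fin b) ℝ) : ℝ :=
  Real.sqrt (∑ i, ∑ j, H i j ^ 2)


section HSHelpers
open ProbabilityTheory

lemma hs_exp_mul_pdf (a x : ℝ) : gaussianPDFReal 0 1 x * Real.exp (a * x ^ 2) =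
    (√(2 * Real.pi))⁻¹ * Real.exp (-(1/2 - a) * x ^ 2) := by
  rw [gaussianPDFReal, mul_assoc, ← Real.exp_add]
  simp only [NNReal.coe_one, mul_one, sub_zero]
  congr 2
  ring

lemma hs_gauss_integrable {a : ℝ} (ha : a < 1/2) :
    Integrable (fun x : ℝ => Real.exp (a * x ^ 2)) (gaussianReal 0 1) := by
  rw [gaussianReal_of_var_ne_zero 0 one_ne_zero]
  rw [integrable_withDensity_iff_integrable_smul' (measurable_gaussianPDF 0 1)
    (Filter.Eventually.of_forall fun x => gaussianPDF_lt_top)]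
  have : (fun x => (gaussianPDF 0 1 x).toReal • Real.exp (a * x ^ 2)) =
      fun x => (√(2 * Real.pi))⁻¹ * Real.exp (-(1/2 - a) * x ^ 2) := by
    funext x
    rw [toReal_gaussianPDF, smul_eq_mul, hs_exp_mul_pdf]
  rw [this]
  exact (integrable_exp_neg_mul_sq (by linarith)).const_mul _

lemma hs_gauss_integral {a : ℝ} (ha : a < 1/2) :
    ∫ x, Real.exp (a * x ^ 2) ∂(gaussianReal 0 1) = (√(1 - 2 * a))⁻¹ := by
  rw [integral_gaussianReal_eq_integral_smul one_ne_zero]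
  simp_rw [smul_eq_mul, hs_exp_mul_pdf]
  rw [integral_const_mul, integral_gaussian, ← Real.sqrt_inv, ← Real.sqrt_inv,
    ← Real.sqrt_mul (by positivity)]
  congr 1
  have h1 : (1 - 2 * a) ≠ 0 := by linarith
  have h2 : (1/2 - a) ≠ 0 := by linarith
  have h3 := Real.pi_ne_zero
  field_simp
  
lemma hs_gauss_lintegral {ι : Type*} [Fintype ι] {E : Type*} [NormedAddCommGroup E]
    [InnerProductSpace ℝ E] [FiniteDimensional ℝ E] [MeasurableSpace E] [BorelSpace E]
    (b : OrthonormalBasis ι ℝ E) (a : ι → ℝ) (ha : ∀ i, a i < 1/2) :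
    ∫⁻ g, ENNReal.ofReal (Real.exp (∑ i, a i * (inner ℝ (b i) g) ^ 2)) ∂(stdGaussian E) =
      ENNReal.ofReal (∏ i, (√(1 - 2 * a i))⁻¹) := by
  rw [stdGaussian_eq_map_pi_orthonormalBasis b, lintegral_map (by fun_prop) (by fun_prop)]
  have h1 : ∀ x : ι → ℝ, Real.exp (∑ i, a i * (inner ℝ (b i) (∑ j, x j • b j)) ^ 2) =
      ∏ i, Real.exp (a i * x i ^ 2) := by
    intro x
    rw [Real.exp_sum]
    congr 1
    funext i
    rw [b.orthonormal.inner_right_fintype]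
  simp_rw [h1]
  rw [← ofReal_integral_eq_lintegral_ofReal]
  · rw [integral_fintype_prod_eq_prod (f := fun i (y : ℝ) => Real.exp (a i * y ^ 2))]
    congr 1
    exact Finset.prod_congr rfl fun i _ => hs_gauss_integral (ha i)
  · exact Integrable.fintype_prod (f := fun i (y : ℝ) => Real.exp (a i * y ^ 2))
      fun i => hs_gauss_integrable (ha i)
  · exact Filter.Eventually.of_forall fun x => by positivity

/-- radial mixing -/
lemma hs_map_prod {E : Type*} [NormedAddCommGroup E]
    [InnerProductSpace ℝ E] [FiniteDimensional ℝ E] [MeasurableSpace E] [BorelSpace E]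
    (ν : Measure E) [IsProbabilityMeasure ν] (hν : ∀ᵐ x ∂ν, ‖x‖ = 1)
    (hinv : ∀ Q : E ≃ₗᵢ[ℝ] E, ν.map Q = ν) :
    ((stdGaussian E).prod ν).map (fun p => ‖p.1‖ • p.2) = stdGaussian E := by
  have hrad : ∀ u v : E, ‖u‖ = ‖v‖ → charFun ν u = charFun ν v := by
    intro u v huv
    let Q : E ≃ₗᵢ[ℝ] E := (Submodule.span ℝ {u - v})ᗮ.reflection
    have hQ : Q u = v := Submodule.reflection_sub huv
    rw [charFun_apply, charFun_apply]
    conv_rhs => rw [← hinv Q]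
    rw [integral_map (by fun_prop) (Measurable.aestronglyMeasurable (by fun_prop)), ← hQ]
    simp
  have hmeas : Measurable (fun p : E × E => ‖p.1‖ • p.2) := by fun_prop
  have : IsProbabilityMeasure (((stdGaussian E).prod ν).map (fun p => ‖p.1‖ • p.2)) :=
    Measure.isProbabilityMeasure_map hmeas.aemeasurable
  have hbound : ∀ r : ℝ, ‖Complex.exp (r * Complex.I)‖ ≤ 1 := fun r => by
    rw [Complex.norm_exp_ofReal_mul_I]
  apply Measure.ext_of_charFun
  ext ξ
  rw [charFun_apply, integral_map hmeas.aemeasurable (Measurable.aestronglyMeasurable (by fun_prop))]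
  rw [integral_prod _ (Integrable.of_bound (Measurable.aestronglyMeasurable (by fun_prop)) 1
    (Filter.Eventually.of_forall fun x => hbound _))]
  have h1 : ∀ g : E, ∫ x, Complex.exp (((inner ℝ (‖g‖ • x) ξ : ℝ) : ℂ) * Complex.I) ∂ν =
      ∫ x, Complex.exp (((inner ℝ g (‖ξ‖ • x) : ℝ) : ℂ) * Complex.I) ∂ν := by
    intro g
    have := hrad (‖g‖ • ξ) (‖ξ‖ • g) (by rw [norm_smul, norm_smul, norm_norm, norm_norm, mul_comm])
    rw [charFun_apply, charFun_apply] at this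
    calc _ = ∫ x, Complex.exp (((inner ℝ x (‖g‖ • ξ) : ℝ) : ℂ) * Complex.I) ∂ν := by
            simp only [real_inner_smul_left, real_inner_smul_right]
      _ = _ := this
      _ = _ := by
            congr 1; funext x
            rw [real_inner_smul_right, real_inner_smul_right, real_inner_comm]
  simp only
  simp_rw [h1]
  rw [integral_integral_swap]
  · have h2 : ∀ᵐ x ∂ν, ∫ g, Complex.exp (((inner ℝ g (‖ξ‖ • x) : ℝ) : ℂ) * Complex.I)
        ∂(stdGaussian E) = charFun (stdGaussian E) ξ := by
      filter_upwards [hν] with x hx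
      rw [← charFun_apply, charFun_stdGaussian, charFun_stdGaussian, norm_smul, norm_norm, hx,
        mul_one]
    rw [integral_congr_ae h2]
    simp
  · exact Integrable.of_bound (Measurable.aestronglyMeasurable (by fun_prop)) 1
      (Filter.Eventually.of_forall fun x => hbound _)

lemma hs_sqrt_lower {a : ℝ} (ha : a < 1/2) : Real.exp a ≤ (√(1 - 2 * a))⁻¹ := by
  rw [← Real.sqrt_inv]
  apply Real.le_sqrt_of_sq_le
  rw [← Real.exp_nat_mul, ← neg_neg ((2:ℕ) * a), Real.exp_neg]
  apply inv_anti₀ (by linarith)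
  have := Real.add_one_le_exp (-((2:ℕ) * a))
  push_cast at *
  linarith

lemma hs_sqrt_upper {a : ℝ} (ha : |a| ≤ 1/4) : (√(1 - 2 * a))⁻¹ ≤ Real.exp (a + 4 * a ^ 2) := by
  obtain ⟨h1, h2⟩ := abs_le.1 ha
  rw [← Real.sqrt_inv]
  apply Real.sqrt_le_iff.2 ⟨by positivity, ?_⟩
  rw [← Real.exp_nat_mul]
  have h0 : 0 < 1 - 2 * a := by linarith
  rw [← Real.log_le_iff_le_exp (by positivity), Real.log_inv]
  push_cast
  have h3 : |2 * a| < 1 := by rw [abs_lt]; constructor <;> linarith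
  have := Real.abs_log_sub_add_sum_range_le h3 1
  simp at this
  have h4 := abs_le.1 this
  have h5 : |a| ^ 2 = a ^ 2 := sq_abs a
  have h6 : (2 * |a|) ^ 2 / (1 - 2 * |a|) ≤ 2 * (2 * |a|) ^ 2 := by
    rw [div_le_iff₀ (by linarith)]
    nlinarith [sq_nonneg (|a|)]
  nlinarith [h4.1, h4.2]

section
variable {ι : Type*} [Fintype ι] {E : Type*} [NormedAddCommGroup E]
    [InnerProductSpace ℝ E] [FiniteDimensional ℝ E] [MeasurableSpace E] [BorelSpace E]

lemma hs_mgf (ν : Measure E) [IsProbabilityMeasure ν] (hν : ∀ᵐ x ∂ν, ‖x‖ = 1)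
    (hinv : ∀ Q : E ≃ₗᵢ[ℝ] E, ν.map Q = ν) (b : OrthonormalBasis ι ℝ E) (l : ι → ℝ)
    (hl0 : ∑ i, l i = 0) {F K s : ℝ} (hF : ∑ i, l i ^ 2 ≤ F ^ 2) (hK : ∀ i, |l i| ≤ K)
    (hs : |s| * K ≤ 1/4) :
    ∫⁻ x, ENNReal.ofReal (Real.exp (s * (Fintype.card ι * ∑ i, l i * (inner ℝ (b i) x) ^ 2))) ∂ν ≤
      ENNReal.ofReal (Real.exp (4 * s ^ 2 * F ^ 2)) := by
  have hsl : ∀ i, |s * l i| ≤ 1/4 := fun i => by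
    rw [abs_mul]
    exact (mul_le_mul_of_nonneg_left (hK i) (abs_nonneg s)).trans hs
  have step1 : ∀ᵐ x ∂ν,
      ENNReal.ofReal (Real.exp (s * (Fintype.card ι * ∑ i, l i * (inner ℝ (b i) x) ^ 2))) ≤
      ∫⁻ g, ENNReal.ofReal (Real.exp (s * ∑ i, l i * (inner ℝ (b i) (‖g‖ • x)) ^ 2))
        ∂(stdGaussian E) := by
    filter_upwards [hν] with x hx
    set q := ∑ i, l i * (inner ℝ (b i) x) ^ 2 with hq
    have hsum : ∑ i, (inner ℝ (b i) x) ^ 2 = 1 := by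
      rw [b.sum_sq_inner_right, hx, one_pow]
    have hsq : s * q ≤ 1/4 := by
      calc s * q = ∑ i, (s * l i) * (inner ℝ (b i) x) ^ 2 := by
            rw [hq, Finset.mul_sum]; exact Finset.sum_congr rfl fun i _ => by ring
        _ ≤ ∑ i, (1/4) * (inner ℝ (b i) x) ^ 2 :=
            Finset.sum_le_sum fun i _ => mul_le_mul_of_nonneg_right
              ((le_abs_self _).trans (hsl i)) (sq_nonneg _)
        _ = 1/4 := by rw [← Finset.mul_sum, hsum, mul_one]
    have h1 : ∀ g : E, s * ∑ i, l i * (inner ℝ (b i) (‖g‖ • x)) ^ 2 =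
        ∑ i, (s * q) * (inner ℝ (b i) g) ^ 2 := by
      intro g
      rw [← Finset.mul_sum, b.sum_sq_inner_right, hq, Finset.mul_sum, Finset.mul_sum,
        Finset.sum_mul]
      refine Finset.sum_congr rfl fun i _ => ?_
      rw [real_inner_smul_right]; ring
    simp_rw [h1]
    rw [hs_gauss_lintegral b (fun _ => s * q) (fun _ => by linarith)]
    apply ENNReal.ofReal_le_ofReal
    rw [Finset.prod_const, Finset.card_univ, mul_left_comm, Real.exp_nat_mul]
    exact pow_le_pow_left₀ (Real.exp_pos _).le (hs_sqrt_lower (by linarith)) _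
  have hmeas : Measurable (fun p : E × E => ‖p.1‖ • p.2) := by fun_prop
  have hfm : Measurable fun x : E =>
      ENNReal.ofReal (Real.exp (s * ∑ i, l i * (inner ℝ (b i) x) ^ 2)) := by fun_prop
  have step2 := lintegral_mono_ae step1
  refine step2.trans ?_
  rw [← lintegral_prod_symm' (μ := stdGaussian E) (ν := ν)
    (fun p => ENNReal.ofReal (Real.exp (s * ∑ i, l i * (inner ℝ (b i) (‖p.1‖ • p.2)) ^ 2)))
    (hfm.comp hmeas)]
  rw [← lintegral_map (μ := (stdGaussian E).prod ν) hfm hmeas, hs_map_prod ν hν hinv]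
  have h2 : ∀ g : E, s * ∑ i, l i * (inner ℝ (b i) g) ^ 2 =
        ∑ i, (s * l i) * (inner ℝ (b i) g) ^ 2 := by
    intro g
    rw [Finset.mul_sum]; exact Finset.sum_congr rfl fun i _ => by ring
  simp_rw [h2]
  rw [hs_gauss_lintegral b (fun i => s * l i)
    (fun i => by linarith [(le_abs_self _).trans (hsl i)])]
  apply ENNReal.ofReal_le_ofReal
  calc ∏ i, (√(1 - 2 * (s * l i)))⁻¹ ≤ ∏ i, Real.exp (s * l i + 4 * (s * l i) ^ 2) :=
        Finset.prod_le_prod (fun i _ => by positivity) fun i _ => hs_sqrt_upper (hsl i)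
    _ = Real.exp (s * ∑ i, l i + 4 * s ^ 2 * ∑ i, l i ^ 2) := by
        rw [← Real.exp_sum, Finset.sum_add_distrib, Finset.mul_sum, Finset.mul_sum]
        congr 2
        exact Finset.sum_congr rfl fun i _ => by ring
    _ ≤ _ := by
        rw [hl0, mul_zero, zero_add]
        exact Real.exp_le_exp.2 (mul_le_mul_of_nonneg_left hF (by positivity))

lemma hs_tail (ν : Measure E) [IsProbabilityMeasure ν] (hν : ∀ᵐ x ∂ν, ‖x‖ = 1)
    (hinv : ∀ Q : E ≃ₗᵢ[ℝ] E, ν.map Q = ν) (b : OrthonormalBasis ι ℝ E) (l : ι → ℝ)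
    (hl0 : ∑ i, l i = 0) {F K T : ℝ} (hF0 : 0 ≤ F) (hK0 : 0 ≤ K) (hT : 0 < T)
    (hF : ∑ i, l i ^ 2 ≤ F ^ 2) (hK : ∀ i, |l i| ≤ K) :
    ν {x | 5 * (F * √T + 4 * K * T) < Fintype.card ι * ∑ i, l i * (inner ℝ (b i) x) ^ 2} ≤
      ENNReal.ofReal (Real.exp (-T)) := by
  have hsT : 0 < √T := Real.sqrt_pos.2 hT
  have hsT2 : √T * √T = T := Real.mul_self_sqrt hT.le
  by_cases hD : F + 4 * K * √T = 0
  · have hF' : F = 0 := by nlinarith [mul_nonneg hK0 hsT.le]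
    have hK' : K = 0 := by
      rw [hF', zero_add] at hD
      rcases mul_eq_zero.1 hD with h | h <;> linarith
    have hl : ∀ i, l i = 0 := fun i => abs_nonpos_iff.1 (hK' ▸ hK i)
    simp [hl, hF', hK']
  have hDp : 0 < F + 4 * K * √T := lt_of_le_of_ne (by positivity) (Ne.symm hD)
  set D := F + 4 * K * √T with hDdef
  set s := √T / D with hsdef
  have hs0 : 0 < s := div_pos hsT hDp
  have hsD : s * D = √T := div_mul_cancel₀ _ hD
  have hsK : |s| * K ≤ 1/4 := by
    rw [abs_of_pos hs0, hsdef, div_mul_eq_mul_div, div_le_iff₀ hDp, hDdef]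
    linarith
  have hsF : s * F ≤ √T := by
    rw [← hsD]
    exact mul_le_mul_of_nonneg_left (by rw [hDdef]; linarith [mul_nonneg hK0 hsT.le]) hs0.le
  have hsF2 : s ^ 2 * F ^ 2 ≤ T := by
    rw [← mul_pow, ← hsT2, ← sq]
    exact pow_le_pow_left₀ (by positivity) hsF 2
  have hm := hs_mgf ν hν hinv b l hl0 hF hK hsK
  have hmk := meas_ge_le_lintegral_div (μ := ν) (f := fun x => ENNReal.ofReal (Real.exp
    (s * (Fintype.card ι * ∑ i, l i * (inner ℝ (b i) x) ^ 2)))) (by fun_prop)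
    (ε := ENNReal.ofReal (Real.exp (5 * T))) (by simp [Real.exp_pos]) (by simp)
  refine (measure_mono ?_).trans (hmk.trans ?_)
  · intro x hx
    simp only [Set.mem_ofPred_eq] at hx ⊢
    apply ENNReal.ofReal_le_ofReal
    apply Real.exp_le_exp.2
    have h1 : s * (5 * (F * √T + 4 * K * T)) = 5 * T := by
      have : F * √T + 4 * K * T = √T * D := by rw [hDdef, ← hsT2, Real.sqrt_mul_self hsT.le]; ring
      rw [this]
      calc s * (5 * (√T * D)) = 5 * √T * (s * D) := by ring
        _ = 5 * T := by rw [hsD, mul_assoc, hsT2]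
    rw [← h1]
    exact mul_le_mul_of_nonneg_left hx.le hs0.le
  · rw [ENNReal.div_le_iff (by simp [Real.exp_pos]) (by simp),
      ← ENNReal.ofReal_mul (Real.exp_pos _).le, ← Real.exp_add]
    refine hm.trans (ENNReal.ofReal_le_ofReal (Real.exp_le_exp.2 ?_))
    linarith

lemma hs_tail_abs (ν : Measure E) [IsProbabilityMeasure ν] (hν : ∀ᵐ x ∂ν, ‖x‖ = 1)
    (hinv : ∀ Q : E ≃ₗᵢ[ℝ] E, ν.map Q = ν) (b : OrthonormalBasis ι ℝ E) (l : ι → ℝ)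
    (hl0 : ∑ i, l i = 0) {F K T : ℝ} (hF0 : 0 ≤ F) (hK0 : 0 ≤ K) (hT : 0 < T)
    (hF : ∑ i, l i ^ 2 ≤ F ^ 2) (hK : ∀ i, |l i| ≤ K) :
    ν {x | 5 * (F * √T + 4 * K * T) < Fintype.card ι * |∑ i, l i * (inner ℝ (b i) x) ^ 2|} ≤
      ENNReal.ofReal (2 * Real.exp (-T)) := by
  have h1 := hs_tail ν hν hinv b l hl0 hF0 hK0 hT hF hK
  have h2 := hs_tail ν hν hinv b (fun i => - l i) (by simp [hl0]) hF0 hK0 hT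
    (by simpa using hF) (by simpa using hK)
  rw [two_mul, ENNReal.ofReal_add (Real.exp_pos _).le (Real.exp_pos _).le]
  refine (measure_mono ?_).trans ((measure_union_le _ _).trans (add_le_add h1 h2))
  intro x hx
  simp only [Set.mem_union, Set.mem_ofPred_eq, neg_mul, Finset.sum_neg_distrib] at hx ⊢
  rcases abs_choice (∑ i, l i * (inner ℝ (b i) x) ^ 2) with h | h
  · left; rwa [h] at hx
  · right; rwa [h] at hx

end

/-- net on the unit sphere -/
lemma hs_net (E : Type*) [NormedAddCommGroup E] [InnerProductSpace ℝ E] [FiniteDimensional ℝ E] :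
    ∃ N : Finset E, N.card ≤ 5 ^ Module.finrank ℝ E ∧ (∀ y ∈ N, ‖y‖ = 1) ∧
      ∀ x : E, ‖x‖ = 1 → ∃ y ∈ N, ‖x - y‖ ≤ 1/2 := by
  classical
  let S : Set ℕ := {k | ∃ s : Finset E, s.card = k ∧ (∀ c ∈ s, ‖c‖ = 1) ∧
    ∀ c ∈ s, ∀ d ∈ s, c ≠ d → 1/2 ≤ ‖c - d‖}
  have hcard : ∀ s : Finset E, (∀ c ∈ s, ‖c‖ = 1) →
      (∀ c ∈ s, ∀ d ∈ s, c ≠ d → 1/2 ≤ ‖c - d‖) → s.card ≤ 5 ^ Module.finrank ℝ E := by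
    intro s h1 h2
    have hinj : Function.Injective (fun c : E => (2:ℝ) • c) := smul_right_injective E two_ne_zero
    rw [← Finset.card_image_of_injective s hinj]
    apply Besicovitch.card_le_of_separated
    · intro cc hcc
      obtain ⟨c, hc, rfl⟩ := Finset.mem_image.1 hcc
      simp [norm_smul, h1 c hc]
    · intro cc hcc dd hdd hcd
      obtain ⟨c, hc, rfl⟩ := Finset.mem_image.1 hcc
      obtain ⟨d, hd, rfl⟩ := Finset.mem_image.1 hdd
      have := h2 c hc d hd (fun h => hcd (by rw [h]))
      rw [← smul_sub, norm_smul, Real.norm_eq_abs, abs_two]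
      linarith
  have hbdd : BddAbove S := ⟨5 ^ Module.finrank ℝ E, by
    rintro k ⟨s, rfl, h1, h2⟩; exact hcard s h1 h2⟩
  have hne : S.Nonempty := ⟨0, ∅, by simp⟩
  obtain ⟨N, hNc, hN1, hN2⟩ := Nat.sSup_mem hne hbdd
  refine ⟨N, hcard N hN1 hN2, hN1, fun x hx => ?_⟩
  by_contra! hcon
  have hxN : x ∉ N := fun h => by
    have := hcon x h
    norm_num at this
  have : N.card + 1 ∈ S := by
    refine ⟨insert x N, Finset.card_insert_of_notMem hxN, ?_, ?_⟩
    · intro c hc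
      rcases Finset.mem_insert.1 hc with rfl | hc
      · exact hx
      · exact hN1 c hc
    · intro c hc d hd hcd
      rcases Finset.mem_insert.1 hc with hc | hc <;> rcases Finset.mem_insert.1 hd with hd | hd
      · exact absurd (hc.trans hd.symm) hcd
      · rw [hc]; exact (hcon d hd).le
      · rw [hd, norm_sub_rev]; exact (hcon c hc).le
      · exact hN2 c hc d hd hcd
  have := le_csSup hbdd this
  omega

lemma hs_norm_net {E : Type*} [NormedAddCommGroup E] [InnerProductSpace ℝ E]
    (T : E →L[ℝ] E) (hT : T.IsSymmetric) (N : Finset E) (hN1 : ∀ y ∈ N, ‖y‖ = 1)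
    (hN : ∀ x : E, ‖x‖ = 1 → ∃ y ∈ N, ‖x - y‖ ≤ 1/2) {B : ℝ} (hB0 : 0 ≤ B)
    (hB : ∀ y ∈ N, |inner ℝ (T y) y| ≤ B) : ‖T‖ ≤ 32 * B := by
  have hunit : ∀ x : E, ‖x‖ = 1 → |inner ℝ (T x) x| ≤ B + ‖T‖ * (31/32) := by
    intro x hx
    obtain ⟨y, hy, hxy⟩ := hN x hx
    have hy1 := hN1 y hy
    have hsym : inner ℝ (T x) y = inner ℝ (T y) x := by
      rw [real_inner_comm]; exact (hT y x).symm
    have e : inner ℝ (T x) x = inner ℝ (T y) y + inner ℝ (T (x + y)) (x - y) := by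
      simp only [map_add, inner_add_left, inner_sub_right]
      rw [hsym]; ring
    have hpar := parallelogram_law_with_norm ℝ x y
    rw [hx, hy1] at hpar
    have hprod : ‖x + y‖ * ‖x - y‖ ≤ 31/32 := by
      apply le_of_sq_le_sq _ (by norm_num)
      have h0 := norm_nonneg (x - y)
      have h1 : ‖x - y‖ ^ 2 ≤ 1/4 := by nlinarith
      rw [mul_pow]
      have h2 : ‖x + y‖ ^ 2 = 4 - ‖x - y‖ ^ 2 := by linarith
      rw [h2]
      nlinarith [sq_nonneg (‖x - y‖)]
    have h3 : |inner ℝ (T (x + y)) (x - y)| ≤ ‖T‖ * (31/32) := by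
      calc _ ≤ ‖T (x + y)‖ * ‖x - y‖ := abs_real_inner_le_norm _ _
        _ ≤ ‖T‖ * ‖x + y‖ * ‖x - y‖ := by gcongr; exact T.le_opNorm _
        _ = ‖T‖ * (‖x + y‖ * ‖x - y‖) := by ring
        _ ≤ _ := by gcongr
    rw [e]
    exact (abs_add_le _ _).trans (add_le_add (hB y hy) h3)
  have hsup : ‖T‖ ≤ B + ‖T‖ * (31/32) := by
    conv_lhs => rw [T.norm_eq_iSup_rayleighQuotient hT]
    apply ciSup_le
    intro x
    by_cases hx : x = 0
    · subst hx
      simp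
      positivity
    · have hx' : ‖x‖ ≠ 0 := norm_ne_zero_iff.2 hx
      rw [← T.rayleigh_smul x (c := (‖x‖⁻¹ : ℝ)) (by positivity)]
      have hn : ‖(‖x‖⁻¹ : ℝ) • x‖ = 1 := by
        rw [norm_smul, norm_inv, norm_norm, inv_mul_cancel₀ hx']
      have := hunit _ hn
      rw [ContinuousLinearMap.rayleighQuotient, hn]
      simpa [ContinuousLinearMap.reApplyInnerSelf_apply] using this
  linarith

/-- The continuous linear map of a matrix. -/
noncomputable def hsOp {a b : ℕ} (H : Matrix (Fin a) (Fin b) ℝ) :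
    EuclideanSpace ℝ (Fin b) →L[ℝ] EuclideanSpace ℝ (Fin a) :=
  LinearMap.toContinuousLinearMap (Matrix.toEuclideanLin H)

lemma hsOp_apply {a b : ℕ} (H : Matrix (Fin a) (Fin b) ℝ) (x : EuclideanSpace ℝ (Fin b)) :
    hsOp H x = WithLp.toLp 2 (H *ᵥ x.ofLp) := rfl

lemma hsOp_mul {a b c : ℕ} (H : Matrix (Fin a) (Fin b) ℝ) (G : Matrix (Fin b) (Fin c) ℝ)
    (x : EuclideanSpace ℝ (Fin c)) : hsOp (H * G) x = hsOp H (hsOp G x) := by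
  simp [hsOp_apply, Matrix.mulVec_mulVec]

lemma hs_inner_dot {a : ℕ} (x y : EuclideanSpace ℝ (Fin a)) :
    inner ℝ x y = x.ofLp ⬝ᵥ y.ofLp := by
  simp [PiLp.inner_apply, dotProduct, mul_comm]

lemma hsOp_adj {a b : ℕ} (H : Matrix (Fin a) (Fin b) ℝ) (x : EuclideanSpace ℝ (Fin b))
    (y : EuclideanSpace ℝ (Fin a)) : inner ℝ (hsOp H x) y = inner ℝ x (hsOp Hᵀ y) := by
  rw [hs_inner_dot, hs_inner_dot, hsOp_apply, hsOp_apply]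
  simp only
  rw [Matrix.mulVec_transpose, dotProduct_comm, Matrix.dotProduct_mulVec, dotProduct_comm]

lemma hsOp_symm {a : ℕ} {H : Matrix (Fin a) (Fin a) ℝ} (hH : Hᵀ = H) :
    (hsOp H).IsSymmetric := by
  intro x y
  change inner ℝ (hsOp H x) y = inner ℝ x (hsOp H y)
  rw [hsOp_adj, hH]

lemma hs_hs_norm {ι κ E : Type*} [Fintype ι] [Fintype κ] [NormedAddCommGroup E]
    [InnerProductSpace ℝ E] (b : OrthonormalBasis ι ℝ E) (c : OrthonormalBasis κ ℝ E)
    (T : E →L[ℝ] E) (hT : T.IsSymmetric) : ∑ i, ‖T (b i)‖ ^ 2 = ∑ j, ‖T (c j)‖ ^ 2 := by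
  simp_rw [← c.sum_sq_inner_right (T (b _)), ← b.sum_sq_inner_left (T (c _))]
  rw [Finset.sum_comm]
  refine Finset.sum_congr rfl fun j _ => Finset.sum_congr rfl fun i _ => ?_
  rw [← ContinuousLinearMap.coe_coe, ← hT]

lemma hs_frob {a : ℕ} (H : Matrix (Fin a) (Fin a) ℝ) :
    ∑ j, ‖hsOp H (EuclideanSpace.basisFun (Fin a) ℝ j)‖ ^ 2 = frobNorm H ^ 2 := by
  rw [frobNorm, Real.sq_sqrt (by positivity), Finset.sum_comm]
  refine Finset.sum_congr rfl fun j _ => ?_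
  rw [EuclideanSpace.real_norm_sq_eq]
  refine Finset.sum_congr rfl fun i _ => ?_
  simp [hsOp_apply]

/-- spectral data for a symmetric trace-free matrix -/
lemma hs_spectral {n : ℕ} (A : Matrix (Fin n) (Fin n) ℝ) (hA : Aᵀ = A) (htr : A.trace = 0) :
    ∃ (b : OrthonormalBasis (Fin n) ℝ (EuclideanSpace ℝ (Fin n))) (l : Fin n → ℝ),
      ∑ i, l i = 0 ∧ ∑ i, l i ^ 2 ≤ frobNorm A ^ 2 ∧ (∀ i, |l i| ≤ specNorm A) ∧
      ∀ x, inner ℝ (hsOp A x) x = ∑ i, l i * (inner ℝ (b i) x) ^ 2 := by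
  have hH : A.IsHermitian := by
    rw [Matrix.IsHermitian, Matrix.conjTranspose_eq_transpose_of_trivial, hA]
  have hev : ∀ i, hsOp A (hH.eigenvectorBasis i) = hH.eigenvalues i • hH.eigenvectorBasis i := by
    intro i
    rw [hsOp_apply, hH.mulVec_eigenvectorBasis]
    rfl
  have hn : ∀ i, ‖hsOp A (hH.eigenvectorBasis i)‖ = |hH.eigenvalues i| := by
    intro i
    rw [hev, norm_smul, hH.eigenvectorBasis.orthonormal.1 i, mul_one, Real.norm_eq_abs]
  refine ⟨hH.eigenvectorBasis, hH.eigenvalues, ?_, ?_, ?_, ?_⟩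
  · have := hH.trace_eq_sum_eigenvalues
    rw [htr] at this
    simpa using this.symm
  · rw [← hs_frob, ← hs_hs_norm hH.eigenvectorBasis _ _ (hsOp_symm hA)]
    simp [hn]
  · intro i
    rw [← hn]
    have := (hsOp A).le_opNorm (hH.eigenvectorBasis i)
    rwa [hH.eigenvectorBasis.orthonormal.1 i, mul_one] at this
  · intro x
    rw [← hH.eigenvectorBasis.sum_inner_mul_inner]
    refine Finset.sum_congr rfl fun i _ => ?_
    rw [hsOp_adj, hA, hev, real_inner_smul_right, real_inner_comm]
    ring

instance hs_borel {d n : ℕ} : BorelSpace (Matrix (Fin d) (Fin n) ℝ) :=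
  inferInstanceAs (BorelSpace (Fin d → Fin n → ℝ))

lemma hs_meas {d n : ℕ} (y : EuclideanSpace ℝ (Fin d)) :
    Measurable (fun P : Matrix (Fin d) (Fin n) ℝ => hsOp Pᵀ y) := by
  apply Continuous.measurable
  simp only [hsOp_apply]
  fun_prop

lemma hs_meas_mul {d n : ℕ} (Q : Matrix (Fin n) (Fin n) ℝ) :
    Measurable (fun P : Matrix (Fin d) (Fin n) ℝ => P * Q) := by
  apply Continuous.measurable
  fun_prop

lemma hs_iso {n : ℕ} (Q : EuclideanSpace ℝ (Fin n) ≃ₗᵢ[ℝ] EuclideanSpace ℝ (Fin n)) :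
    ∃ M : Matrix (Fin n) (Fin n) ℝ, Mᵀ ∈ Matrix.orthogonalGroup (Fin n) ℝ ∧
      ∀ x, Q x = hsOp M x := by
  let M : Matrix (Fin n) (Fin n) ℝ := Matrix.toEuclideanLin.symm Q.toLinearEquiv.toLinearMap
  have hM : ∀ x, Q x = hsOp M x := by
    intro x
    have : Matrix.toEuclideanLin M = Q.toLinearEquiv.toLinearMap :=
      LinearEquiv.apply_symm_apply _ _
    rw [hsOp]
    simp [this]
  refine ⟨M, ?_, hM⟩
  rw [Matrix.mem_orthogonalGroup_iff, Matrix.transpose_transpose]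
  have key : ∀ x y : EuclideanSpace ℝ (Fin n), inner ℝ x (hsOp (Mᵀ * M) y) = inner ℝ x y := by
    intro x y
    rw [hsOp_mul, ← hsOp_adj, ← hM, ← hM, Q.inner_map_map]
  apply Matrix.toEuclideanLin.injective
  ext1 y
  rw [Matrix.toLpLin_one]
  exact ext_inner_left ℝ fun x => key x y

lemma hs_fixed {d n : ℕ} {μ : Measure (Matrix (Fin d) (Fin n) ℝ)} (hμ : IsHaarStiefel μ)
    (A : Matrix (Fin n) (Fin n) ℝ) (hA : Aᵀ = A) (htr : A.trace = 0) {T : ℝ} (hT : 0 < T)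
    (y : EuclideanSpace ℝ (Fin d)) (hy : ‖y‖ = 1) :
    μ {P | 5 * (frobNorm A * √T + 4 * specNorm A * T) <
        n * |inner ℝ (hsOp (P * A * Pᵀ) y) y|} ≤ ENNReal.ofReal (2 * Real.exp (-T)) := by
  obtain ⟨hprob, hst, hinv⟩ := hμ
  obtain ⟨b, l, hl0, hF, hK, hq⟩ := hs_spectral A hA htr
  have hm := hs_meas (n := n) y
  let ν := μ.map (fun P => hsOp Pᵀ y)
  have hνp : IsProbabilityMeasure ν := Measure.isProbabilityMeasure_map hm.aemeasurable
  have hν1 : ∀ᵐ x ∂ν, ‖x‖ = 1 := by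
    rw [ae_map_iff hm.aemeasurable (measurableSet_eq_fun (by fun_prop) (by fun_prop))]
    filter_upwards [hst] with P hP
    have : ‖hsOp Pᵀ y‖ ^ 2 = 1 := by
      rw [← real_inner_self_eq_norm_sq, hsOp_adj, ← hsOp_mul, Matrix.transpose_transpose, hP,
        hsOp_apply, Matrix.one_mulVec, WithLp.toLp_ofLp, real_inner_self_eq_norm_sq, hy, one_pow]
    nlinarith [norm_nonneg (hsOp Pᵀ y)]
  have hνinv : ∀ Q : EuclideanSpace ℝ (Fin n) ≃ₗᵢ[ℝ] EuclideanSpace ℝ (Fin n), ν.map Q = ν := by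
    intro Q
    obtain ⟨M, hM, hQ⟩ := hs_iso Q
    have h1 : (fun x => Q x) ∘ (fun P : Matrix (Fin d) (Fin n) ℝ => hsOp Pᵀ y) =
        (fun P => hsOp Pᵀ y) ∘ (fun P => P * Mᵀ) := by
      funext P
      simp only [Function.comp]
      rw [hQ, ← hsOp_mul, Matrix.transpose_mul, Matrix.transpose_transpose]
    calc ν.map Q = μ.map ((fun x => Q x) ∘ (fun P => hsOp Pᵀ y)) :=
          Measure.map_map (by fun_prop) hm
      _ = (μ.map (fun P => P * Mᵀ)).map (fun P => hsOp Pᵀ y) := by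
          rw [h1, Measure.map_map hm (hs_meas_mul _)]
      _ = ν := by rw [hinv _ hM]
  have ht := hs_tail_abs ν hν1 hνinv b l hl0 (F := frobNorm A) (K := specNorm A)
    (Real.sqrt_nonneg _) (norm_nonneg _) hT hF hK
  rw [Fintype.card_fin] at ht
  refine le_trans (le_of_eq_of_le ?_ (Measure.le_map_apply hm.aemeasurable _)) ht
  congr 1
  ext P
  simp only [Set.mem_ofPred_eq, Set.mem_preimage]
  rw [← hq, Matrix.mul_assoc, hsOp_mul, hsOp_adj, hsOp_mul]


lemma hs_eig {d n : ℕ} {H : Matrix (Fin n) (Fin n) ℝ} (hH : H.PosSemidef)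
    (P : Matrix (Fin d) (Fin n) ℝ) {r e : ℝ}
    (h : specNorm (P * H * Pᵀ - r • (1 : Matrix (Fin d) (Fin d) ℝ)) ≤ e) (t : ℝ) (w : Fin d → ℝ)
    (hw : w ≠ 0) (hwt : (P * H * Pᵀ).mulVec w = t • w) : max (r - e) 0 ≤ t ∧ t ≤ r + e := by
  have hPSD : (P * H * Pᵀ).PosSemidef := by
    have := hH.mul_mul_conjTranspose_same P
    rwa [Matrix.conjTranspose_eq_transpose_of_trivial] at this
  have ht0 : 0 ≤ t := by
    have h1 := hPSD.dotProduct_mulVec_nonneg w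
    rw [hwt, star_trivial, dotProduct_smul, smul_eq_mul] at h1
    have h2 : 0 < w ⬝ᵥ w := by
      have := dotProduct_star_self_pos_iff.2 hw
      rwa [star_trivial] at this
    exact nonneg_of_mul_nonneg_left h1 h2
  have hx : (WithLp.toLp 2 w : EuclideanSpace ℝ (Fin d)) ≠ 0 := by
    intro h0
    apply hw
    have := congrArg WithLp.ofLp h0
    simpa using this
  have h3 : hsOp (P * H * Pᵀ - r • (1 : Matrix (Fin d) (Fin d) ℝ)) (WithLp.toLp 2 w) =
      (t - r) • WithLp.toLp 2 w := by
    rw [hsOp_apply]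
    simp only
    rw [Matrix.sub_mulVec, hwt, Matrix.smul_mulVec, Matrix.one_mulVec, ← sub_smul]
    rfl
  have h4 := (hsOp (P * H * Pᵀ - r • (1 : Matrix (Fin d) (Fin d) ℝ))).le_opNorm (WithLp.toLp 2 w)
  rw [h3, norm_smul] at h4
  have h5 : |t - r| ≤ e := (le_of_mul_le_mul_right h4 (norm_pos_iff.2 hx)).trans h
  obtain ⟨h6, h7⟩ := abs_le.1 h5
  exact ⟨max_le (by linarith) ht0, by linarith⟩


end HSHelpers

/-- Direct Haar spectral sandwich: there exist universal constants `c, C > 0` such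
that for any symmetric PSD `H ∈ ℝ^{n×n}`, `λ̄ = tr(H)/n`, `H_c = H − λ̄ I`,
`1 ≤ d ≤ n`, Haar–Stiefel `P ∈ ℝ^{d×n}`, and `η ∈ (0,1)`, with
`err = C ((‖H_c‖_F/n)√(d + log(2/η)) + (‖H_c‖₂/n)(d + log(2/η)))`, with
probability at least `1 − η` one has `‖P H Pᵀ − λ̄ I_d‖ ≤ err`, and hence every
eigenvalue of `P H Pᵀ` lies in `[max{λ̄ − err, 0}, λ̄ + err]`. -/
theorem haar_spectral_sandwich :
    ∃ c : ℝ, 0 < c ∧ ∃ C : ℝ, 0 < C ∧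
      ∀ n : ℕ, 1 ≤ n → ∀ H : Matrix (Fin n) (Fin n) ℝ, H.PosSemidef →
      ∀ d : ℕ, 1 ≤ d → d ≤ n →
      ∀ μ : Measure (Matrix (Fin d) (Fin n) ℝ), IsHaarStiefel μ →
      ∀ η : ℝ, 0 < η → η < 1 →
        ENNReal.ofReal (1 - η) ≤
          μ {P | specNorm (P * H * Pᵀ - (Matrix.trace H / n) • (1 : Matrix (Fin d) (Fin d) ℝ)) ≤
              C * ((frobNorm (H - (Matrix.trace H / n) • (1 : Matrix (Fin n) (Fin n) ℝ)) / n) *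
                    Real.sqrt ((d : ℝ) + Real.log (2 / η)) +
                  (specNorm (H - (Matrix.trace H / n) • (1 : Matrix (Fin n) (Fin n) ℝ)) / n) *
                    ((d : ℝ) + Real.log (2 / η))) ∧
            ∀ (t : ℝ) (w : Fin d → ℝ), w ≠ 0 → (P * H * Pᵀ).mulVec w = t • w →
              max (Matrix.trace H / n -
                  C * ((frobNorm (H - (Matrix.trace H / n) • (1 : Matrix (Fin n) (Fin n) ℝ)) / n) *
                        Real.sqrt ((d : ℝ) + Real.log (2 / η)) +
                      (specNorm (H - (Matrix.trace H / n) • (1 : Matrix (Fin n) (Fin n) ℝ)) / n) *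
                        ((d : ℝ) + Real.log (2 / η)))) 0 ≤ t ∧
              t ≤ Matrix.trace H / n +
                  C * ((frobNorm (H - (Matrix.trace H / n) • (1 : Matrix (Fin n) (Fin n) ℝ)) / n) *
                        Real.sqrt ((d : ℝ) + Real.log (2 / η)) +
                      (specNorm (H - (Matrix.trace H / n) • (1 : Matrix (Fin n) (Fin n) ℝ)) / n) *
                        ((d : ℝ) + Real.log (2 / η)))} := by
  refine ⟨1, one_pos, 2000, by norm_num, ?_⟩
  intro n hn H hH d hd hdn μ hμ η hη0 hη1
  set r : ℝ := Matrix.trace H / n with hr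
  set A := H - r • (1 : Matrix (Fin n) (Fin n) ℝ) with hAdef
  set D : ℝ := (d : ℝ) + Real.log (2 / η) with hD
  set e := 2000 * (frobNorm A / n * √D + specNorm A / n * D) with he
  have hn0 : (0 : ℝ) < n := by exact_mod_cast hn
  have hHt : Hᵀ = H := by
    have := hH.isHermitian
    rwa [Matrix.IsHermitian, Matrix.conjTranspose_eq_transpose_of_trivial] at this
  have hAt : Aᵀ = A := by
    rw [hAdef, Matrix.transpose_sub, Matrix.transpose_smul, Matrix.transpose_one, hHt]
  have hAtr : A.trace = 0 := by
    rw [hAdef, Matrix.trace_sub, Matrix.trace_smul, Matrix.trace_one, Fintype.card_fin, hr,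
      smul_eq_mul, div_mul_cancel₀ _ hn0.ne', sub_self]
  have hL : 0 < Real.log (2 / η) := by
    apply Real.log_pos
    rw [lt_div_iff₀ hη0]
    linarith
  have hd1 : (1 : ℝ) ≤ d := by exact_mod_cast hd
  have hDpos : 0 < D := by rw [hD]; linarith
  have hF0 : 0 ≤ frobNorm A := Real.sqrt_nonneg _
  have hK0 : 0 ≤ specNorm A := norm_nonneg _
  obtain ⟨N, hNc, hN1, hN⟩ := hs_net (EuclideanSpace ℝ (Fin d))
  rw [finrank_euclideanSpace_fin] at hNc
  have hT : 0 < 3 * D := by linarith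
  let bad : EuclideanSpace ℝ (Fin d) → Set (Matrix (Fin d) (Fin n) ℝ) := fun y =>
    {P | 5 * (frobNorm A * √(3 * D) + 4 * specNorm A * (3 * D)) <
        n * |inner ℝ (hsOp (P * A * Pᵀ) y) y|}
  have hbad : ∀ y ∈ N, μ (bad y) ≤ ENNReal.ofReal (2 * Real.exp (-(3 * D))) := fun y hy =>
    hs_fixed hμ A hAt hAtr hT y (hN1 y hy)
  have hprob := hμ.1
  have hst := hμ.2.1
  have hunion : μ (⋃ y ∈ N, bad y) ≤ ENNReal.ofReal η := by
    calc μ (⋃ y ∈ N, bad y) ≤ ∑ y ∈ N, μ (bad y) := measure_biUnion_finset_le _ _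
      _ ≤ ∑ y ∈ N, ENNReal.ofReal (2 * Real.exp (-(3 * D))) := Finset.sum_le_sum hbad
      _ = ENNReal.ofReal (N.card * (2 * Real.exp (-(3 * D)))) := by
          rw [Finset.sum_const, nsmul_eq_mul, ENNReal.ofReal_mul (p := (N.card : ℝ)) (by positivity),
            ENNReal.ofReal_natCast]
      _ ≤ ENNReal.ofReal η := by
          apply ENNReal.ofReal_le_ofReal
          have h5 : (N.card : ℝ) ≤ Real.exp (2 * d) := by
            have h51 : (5 : ℝ) ≤ Real.exp 2 := by
              have h52 : Real.exp 2 = Real.exp 1 * Real.exp 1 := by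
                rw [← Real.exp_add]; norm_num
              nlinarith [Real.exp_one_gt_d9]
            calc (N.card : ℝ) ≤ ((5 ^ d : ℕ) : ℝ) := by exact_mod_cast hNc
              _ = (5 : ℝ) ^ d := by push_cast; rfl
              _ ≤ (Real.exp 2) ^ d := pow_le_pow_left₀ (by norm_num) h51 d
              _ = Real.exp (2 * d) := by rw [← Real.exp_nat_mul, mul_comm]
          have h6 : Real.exp (-Real.log (2 / η)) = η / 2 := by
            rw [Real.exp_neg, Real.exp_log (by positivity), inv_div]
          calc (N.card : ℝ) * (2 * Real.exp (-(3 * D)))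
              ≤ Real.exp (2 * d) * (2 * Real.exp (-(3 * D))) := by gcongr
            _ = 2 * Real.exp (2 * d + -(3 * D)) := by rw [Real.exp_add]; ring
            _ ≤ 2 * Real.exp (-Real.log (2 / η)) := by
                gcongr
                rw [hD]; linarith
            _ = η := by rw [h6]; ring
  have hdet : ∀ P : Matrix (Fin d) (Fin n) ℝ, P * Pᵀ = 1 → P ∉ ⋃ y ∈ N, bad y →
      specNorm (P * H * Pᵀ - r • (1 : Matrix (Fin d) (Fin d) ℝ)) ≤ e := by
    intro P hP hPb
    have hPA : P * H * Pᵀ - r • (1 : Matrix (Fin d) (Fin d) ℝ) = P * A * Pᵀ := by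
      rw [hAdef, Matrix.mul_sub, Matrix.sub_mul, Matrix.mul_smul, Matrix.mul_one, Matrix.smul_mul,
        hP]
    rw [hPA]
    have hsym : (P * A * Pᵀ)ᵀ = P * A * Pᵀ := by
      rw [Matrix.transpose_mul, Matrix.transpose_mul, Matrix.transpose_transpose, hAt,
        Matrix.mul_assoc]
    have hB := hs_norm_net (hsOp (P * A * Pᵀ)) (hsOp_symm hsym) N hN1 hN
      (B := 5 * (frobNorm A * √(3 * D) + 4 * specNorm A * (3 * D)) / n) (by positivity) (by
        intro y hy
        have h1 : P ∉ bad y := fun h => hPb (Set.mem_biUnion hy h)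
        rw [le_div_iff₀ hn0, mul_comm]
        exact not_lt.1 h1)
    refine le_trans hB ?_
    have hsq : √(3 * D) ≤ 2 * √D := by
      apply Real.sqrt_le_iff.2 ⟨by positivity, ?_⟩
      rw [mul_pow, Real.sq_sqrt hDpos.le]
      linarith
    have h1 : frobNorm A * √(3 * D) ≤ frobNorm A * (2 * √D) := mul_le_mul_of_nonneg_left hsq hF0
    have h2 : 0 ≤ frobNorm A * √D := by positivity
    have h3 : 0 ≤ specNorm A * D := by positivity
    calc 32 * (5 * (frobNorm A * √(3 * D) + 4 * specNorm A * (3 * D)) / n)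
        = (160 * (frobNorm A * √(3 * D) + 4 * specNorm A * (3 * D))) / n := by ring
      _ ≤ (2000 * (frobNorm A * √D + specNorm A * D)) / n := by
          gcongr ?_ / _
          linarith
      _ = e := by rw [he]; ring
  set S := {P : Matrix (Fin d) (Fin n) ℝ |
    specNorm (P * H * Pᵀ - r • (1 : Matrix (Fin d) (Fin d) ℝ)) ≤ e ∧
      ∀ (t : ℝ) (w : Fin d → ℝ), w ≠ 0 → (P * H * Pᵀ).mulVec w = t • w →
        max (r - e) 0 ≤ t ∧ t ≤ r + e} with hS
  have hSc : μ Sᶜ ≤ ENNReal.ofReal η := by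
    refine le_trans (measure_mono_ae ?_) hunion
    filter_upwards [hst] with P hP hPS
    by_contra hcon
    have h1 := hdet P hP hcon
    exact hPS ⟨h1, fun t w hw hwt => hs_eig hH P h1 t w hw hwt⟩
  have h1 : (1 : ENNReal) ≤ μ S + ENNReal.ofReal η := by
    calc (1 : ENNReal) = μ (S ∪ Sᶜ) := by rw [Set.union_compl_self, measure_univ]
      _ ≤ μ S + μ Sᶜ := measure_union_le _ _
      _ ≤ _ := by gcongr
  rw [ENNReal.ofReal_sub _ hη0.le, ENNReal.ofReal_one]
  exact tsub_le_iff_right.2 h1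
end
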